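/- There exist a field K, finite-dimensional K-algebras S and R, and a finite-dimensional S-R-bimodule C which is a cotilting bimodule, such that there is NO S-R-bimodule D containing C as a sub-bimodule whose underlying left S-module is an injective envelope of the left S-module C, while there IS an S-R-bimodule D' containing C as a sub-bimodule whose underlying right R-module is an injective envelope of the right R-module C. In particular, it is not always possible to embed a finite-dimensional cotilting bimodule into a bimodule whose underlying left module is the injective envelope, and no left–right symmetry holds for this embedding problem. -/

import Mathlib

open CategoryTheory

noncomputable section

/-! ### Generalities -/

section Generalities

variable (A : Type) [Ring A]

/-- `Ext^n_A(M, N) = 0`. -/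
def ExtVanish (M N : ModuleCat.{0} A) (n : ℕ) : Prop :=
  Subsingleton (((Ext ℤ (ModuleCat.{0} A) n).obj (Opposite.op M)).obj N)

/-- `N ∈ Prod M`: `N` is a direct summand of a direct product of copies of `M`. -/
def InProd (M N : ModuleCat.{0} A) : Prop :=
  ∃ (ι : Type) (s : N ⟶ ModuleCat.of A (ι → M)) (r : ModuleCat.of A (ι → M) ⟶ N),
    s ≫ r = 𝟙 N

/-- `Q` is an injective cogenerator of the category of left `A`-modules. -/
def IsInjectiveCogenerator (Q : ModuleCat.{0} A) : Prop :=
  Injective Q ∧ ∀ X : ModuleCat.{0} A, ∃ (ι : Type) (f : X ⟶ ModuleCat.of A (ι → Q)),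
    Function.Injective f

/-- `C` is a classical cotilting left `A`-module: (i) `C` has injective dimension at most `1`;
(ii) `Ext¹(C^I, C) = 0` for every direct product of copies of `C`; (iii) there is a short
exact sequence `0 → C' → C'' → Q → 0` with `Q` an injective cogenerator and
`C', C'' ∈ Prod C`. -/
def IsClassicalCotilting (C : Type) [AddCommGroup C] [Module A C] : Prop :=
  (∀ (X : ModuleCat.{0} A) (i : ℕ), 1 < i → ExtVanish A X (ModuleCat.of A C) i) ∧
  (∀ ι : Type, ExtVanish A (ModuleCat.of A (ι → C)) (ModuleCat.of A C) 1) ∧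
  (∃ (Q C' C'' : ModuleCat.{0} A) (f : C' ⟶ C'') (g : C'' ⟶ Q),
    IsInjectiveCogenerator A Q ∧ InProd A (ModuleCat.of A C) C' ∧
    InProd A (ModuleCat.of A C) C'' ∧
    Function.Injective f ∧ Function.Surjective g ∧ Function.Exact f g)

/-- `E`, together with the embedding `j`, is an injective envelope of `C`:
`E` is injective, `j` is injective, and the image of `j` is essential in `E`. -/
def IsInjEnvelope (C E : Type) [AddCommGroup C] [Module A C]
    [AddCommGroup E] [Module A E] (j : C →ₗ[A] E) : Prop :=
  Module.Injective A E ∧ Function.Injective j ∧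
    ∀ N : Submodule A E, N ≠ ⊥ → N ⊓ LinearMap.range j ≠ ⊥

variable (B : Type) [Ring B]

/-- an `A`-linear endomorphism commuting with a second (commuting) `B`-action, i.e. an
endomorphism of bimodules. -/
def CommutesWith (M : Type) [AddCommGroup M] [Module A M] [Module B M]
    (p : M →ₗ[A] M) : Prop :=
  ∀ (b : B) (x : M), p (b • x) = b • p x

/-- a bimodule (with commuting `A`- and `B`-actions) is indecomposable iff it is nonzero and
its only idempotent bimodule endomorphisms are `0` and the identity. -/
def BimodIndecomposable (M : Type) [AddCommGroup M] [Module A M] [Module B M] : Prop :=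
  Nontrivial M ∧ ∀ p : M →ₗ[A] M, CommutesWith A B M p → p ∘ₗ p = p →
    p = 0 ∨ p = LinearMap.id

/-- a bimodule is a direct sum of two nonzero sub-bimodules iff it admits a nontrivial
idempotent bimodule endomorphism. -/
def BimodDecomposable (M : Type) [AddCommGroup M] [Module A M] [Module B M] : Prop :=
  ∃ p : M →ₗ[A] M, CommutesWith A B M p ∧ p ∘ₗ p = p ∧ p ≠ 0 ∧ p ≠ LinearMap.id

end Generalities

/-- `C`, an `S`-`R`-bimodule over a field `K` (both algebras and the bimodule being
finite-dimensional over `K`), is a cotilting bimodule: it is faithfully balanced and is a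
classical cotilting module on both sides. -/
def IsCotiltingBimodule (K S R C : Type) [Field K] [Ring S] [Algebra K S] [Ring R]
    [Algebra K R] [AddCommGroup C] [Module S C] [Module Rᵐᵒᵖ C] [SMulCommClass S Rᵐᵒᵖ C] :
    Prop :=
  haveI : SMulCommClass Rᵐᵒᵖ S C := SMulCommClass.symm S Rᵐᵒᵖ C
  Function.Bijective (Module.toModuleEnd Rᵐᵒᵖ C : S →+* Module.End Rᵐᵒᵖ C) ∧
  Function.Bijective (Module.toModuleEnd S C : Rᵐᵒᵖ →+* Module.End S C) ∧
  IsClassicalCotilting S C ∧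
  IsClassicalCotilting Rᵐᵒᵖ C

/-- The left `S`-module `E`, containing the `S`-`R`-bimodule `C` via `j`, admits a right
`R`-module structure making it an `S`-`R`-bimodule containing `C` as a sub-bimodule. -/
def HasRightExtension (S R : Type) [Ring S] [Ring R] (C E : Type) [AddCommGroup C]
    [Module S C] [Module Rᵐᵒᵖ C] [AddCommGroup E] [Module S E] (j : C →ₗ[S] E) : Prop :=
  ∃ m : Module Rᵐᵒᵖ E,
    (by letI := m; exact
      (∀ (s : S) (r : Rᵐᵒᵖ) (x : E), s • r • x = r • s • x) ∧
      (∀ (r : Rᵐᵒᵖ) (c : C), j (r • c) = r • j c) : Prop)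

/-! ### Statement 13: the bad case -/

/-- The data asserted to exist in Statement 13: a finite-dimensional cotilting
`S`-`R`-bimodule `C` such that no injective envelope of the left `S`-module `C` admits a
compatible bimodule structure containing `C`, while some injective envelope of the right
`R`-module `C` does. -/
structure BadCaseExample where
  K : Type
  [fK : Field K]
  S : Type
  [rS : Ring S]
  [aS : Algebra K S]
  finS : FiniteDimensional K S
  R : Type
  [rR : Ring R]
  [aR : Algebra K R]
  finR : FiniteDimensional K R
  C : Type
  [abC : AddCommGroup C]
  [mSC : Module S C]
  [mRC : Module Rᵐᵒᵖ C]
  [sccC : SMulCommClass S Rᵐᵒᵖ C]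
  [mKC : Module K C]
  [towSC : IsScalarTower K S C]
  [towRC : IsScalarTower K Rᵐᵒᵖ C]
  finC : FiniteDimensional K C
  cotilting : IsCotiltingBimodule K S R C
  /-- there is NO bimodule `D ⊇ C` whose underlying left `S`-module is an injective
  envelope of the left `S`-module `C` -/
  noLeftExt : ∀ (E : Type) [AddCommGroup E] [Module S E] (j : C →ₗ[S] E),
    IsInjEnvelope S C E j → ¬ HasRightExtension S R C E j
  -- an injective envelope of the right `R`-module `C`, supporting a bimodule `D' ⊇ C`
  E' : Type
  [abE' : AddCommGroup E']
  [mRE' : Module Rᵐᵒᵖ E']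
  j' : C →ₗ[Rᵐᵒᵖ] E'
  envE' : IsInjEnvelope Rᵐᵒᵖ C E' j'
  [mSE' : Module S E']
  [sccE' : SMulCommClass S Rᵐᵒᵖ E']
  j'_left_linear : ∀ (s : S) (c : C), j' (s • c) = s • j' c

/-! ### Vanishing of `Ext` from a short injective coresolution -/

section CotiltingCriterion

variable {A : Type} [Ring A]

open ProjectiveResolution in
theorem extVanish_succ_of_factors {M N : ModuleCat.{0} A} (P : ProjectiveResolution M) (n : ℕ)
    (h : ∀ f : P.complex.X (n + 1) ⟶ N, P.complex.d (n + 2) (n + 1) ≫ f = 0 →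
      ∃ g : P.complex.X n ⟶ N, P.complex.d (n + 1) n ≫ g = f) :
    ExtVanish A M N (n + 1) := by
  unfold ExtVanish
  rw [← ModuleCat.isZero_iff_subsingleton]
  refine Limits.IsZero.of_iso ?_ (P.isoExt (n + 1) N)
  rw [← HomologicalComplex.exactAt_iff_isZero_homology,
    HomologicalComplex.exactAt_iff' _ n (n + 1) (n + 2) (by simp) (by simp),
    ShortComplex.moduleCat_exact_iff]
  exact h

theorem exists_sub_factor {P₁ P₀ C E F : ModuleCat.{0} A} {i : C ⟶ E} {p : E ⟶ F}
    (hi : Function.Injective i) (hip : Function.Exact i p) (d : P₁ ⟶ P₀) (f : P₁ ⟶ C)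
    (g h : P₀ ⟶ E) (hg : d ≫ g = f ≫ i) (hp : h ≫ p = g ≫ p) (hd : d ≫ h = 0) :
    ∃ k : P₀ ⟶ C, d ≫ k = f := by
  have : Mono i := (ModuleCat.mono_iff_injective i).2 hi
  have zero : i ≫ p = 0 := by ext x; exact hip.apply_apply_eq_zero x
  have ex : (ShortComplex.mk i p zero).Exact := by
    rw [ShortComplex.moduleCat_exact_iff]
    exact fun x hx => (hip x).1 hx
  refine ⟨ex.lift (g - h) (by simp [hp]), ?_⟩
  rw [← cancel_mono i, Category.assoc]
  have := ex.lift_f (g - h) (by simp [hp])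
  dsimp at this
  rw [this, Preadditive.comp_sub, hg, hd, sub_zero]

theorem extVanish_of_injective_coresolution {C E F : ModuleCat.{0} A} {i : C ⟶ E} {p : E ⟶ F}
    (hi : Function.Injective i) (hip : Function.Exact i p) (hp : Function.Surjective p)
    [Injective E] [Injective F] (X : ModuleCat.{0} A) (n : ℕ) (hn : 1 < n) :
    ExtVanish A X C n := by
  obtain ⟨n, rfl⟩ := Nat.exists_eq_add_of_lt hn
  rw [show 1 + n + 1 = n + 1 + 1 by omega]
  obtain ⟨⟨P⟩⟩ := (inferInstance : HasProjectiveResolution X)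
  refine extVanish_succ_of_factors P _ fun f hf => ?_
  have : Epi p := (ModuleCat.epi_iff_surjective p).2 hp
  have zero : i ≫ p = 0 := by ext x; exact hip.apply_apply_eq_zero x
  let g := (P.exact_succ (n + 1)).descToInjective (f ≫ i) (by simp [reassoc_of% hf])
  have hg : P.complex.d (n + 2) (n + 1) ≫ g = f ≫ i :=
    (P.exact_succ (n + 1)).comp_descToInjective _ _
  have hgp : P.complex.d (n + 2) (n + 1) ≫ g ≫ p = 0 := by
    rw [reassoc_of% hg, zero, Limits.comp_zero]
  let h := (P.exact_succ n).descToInjective (g ≫ p) hgp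
  have hh : P.complex.d (n + 1) n ≫ h = g ≫ p := (P.exact_succ n).comp_descToInjective _ _
  exact exists_sub_factor hi hip _ f g (P.complex.d (n + 1) n ≫ Projective.factorThru h p) hg
    (by simp [hh]) (by simp)

theorem extVanish_one_of_lift {C E F X : ModuleCat.{0} A} {i : C ⟶ E} {p : E ⟶ F}
    (hi : Function.Injective i) (hip : Function.Exact i p) [Injective E]
    (hX : ∀ φ : X ⟶ F, ∃ ψ : X ⟶ E, ψ ≫ p = φ) :
    ExtVanish A X C 1 := by
  obtain ⟨⟨P⟩⟩ := (inferInstance : HasProjectiveResolution X)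
  refine extVanish_succ_of_factors P _ fun f hf => ?_
  have zero : i ≫ p = 0 := by ext x; exact hip.apply_apply_eq_zero x
  let g := (P.exact_succ 0).descToInjective (f ≫ i) (by simp [reassoc_of% hf])
  have hg : P.complex.d 1 0 ≫ g = f ≫ i := (P.exact_succ 0).comp_descToInjective _ _
  obtain ⟨φ, hφ⟩ := Limits.CokernelCofork.IsColimit.desc' P.isColimitCokernelCofork (g ≫ p)
    (by rw [reassoc_of% hg, zero, Limits.comp_zero])
  obtain ⟨ψ, hψ⟩ := hX φ
  exact exists_sub_factor hi hip _ f g (P.π.f 0 ≫ ψ) hg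
    (by rw [← hφ, ← hψ]; rfl)
    ((Category.assoc _ _ _).symm.trans
      ((congrArg (· ≫ ψ) P.complex_d_comp_π_f_zero).trans Limits.zero_comp))

/-- A criterion for being classical cotilting: `C` has a coresolution `0 → C → E → F → 0` by
injectives with `E` a summand of a power of `C` and `E × F` a cogenerator, along which maps
from powers of `C` lift. -/
theorem isClassicalCotilting_of_coresolution (C E F : Type) [AddCommGroup C] [Module A C]
    [AddCommGroup E] [Module A E] [AddCommGroup F] [Module A F]
    [Module.Injective A E] [Module.Injective A F] (i : C →ₗ[A] E) (p : E →ₗ[A] F)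
    (hi : Function.Injective i) (hip : Function.Exact i p) (hp : Function.Surjective p)
    (hlift : ∀ (ι : Type) (φ : (ι → C) →ₗ[A] F), ∃ ψ : (ι → C) →ₗ[A] E, p ∘ₗ ψ = φ)
    (κ : Type) (s : E →ₗ[A] κ → C) (r : (κ → C) →ₗ[A] E) (hsr : r ∘ₗ s = LinearMap.id)
    (hcog : ∀ (X : Type) [AddCommGroup X] [Module A X] (x : X), x ≠ 0 →
      ∃ φ : X →ₗ[A] E × F, φ x ≠ 0) :
    IsClassicalCotilting A C := by
  have hsr' : ∀ x, r (s x) = x := fun x => LinearMap.congr_fun hsr x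
  have : Injective (ModuleCat.of A E) := Module.injective_object_of_injective_module A E
  have : Injective (ModuleCat.of A F) := Module.injective_object_of_injective_module A F
  refine ⟨extVanish_of_injective_coresolution (i := ModuleCat.ofHom i) (p := ModuleCat.ofHom p)
    hi hip hp, fun ι => extVanish_one_of_lift (i := ModuleCat.ofHom i) (p := ModuleCat.ofHom p)
    hi hip fun φ => ?_, ?_⟩
  · obtain ⟨ψ, hψ⟩ := hlift ι φ.hom
    exact ⟨ModuleCat.ofHom ψ, by ext1; exact hψ⟩
  · refine ⟨ModuleCat.of A (E × F), ModuleCat.of A C, ModuleCat.of A (E × E),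
      ModuleCat.ofHom ((LinearMap.inr A E E) ∘ₗ i),
      ModuleCat.ofHom (LinearMap.prodMap LinearMap.id p), ⟨?_, fun X => ?_⟩, ?_, ?_, ?_, ?_, ?_⟩
    · have : Module.Injective A (E × F) := by
        constructor
        intro X Y _ _ _ _ f hf g
        obtain ⟨h₁, H₁⟩ := Module.Injective.out f hf (LinearMap.fst A E F ∘ₗ g)
        obtain ⟨h₂, H₂⟩ := Module.Injective.out f hf (LinearMap.snd A E F ∘ₗ g)
        exact ⟨h₁.prod h₂, fun x => Prod.ext (H₁ x) (H₂ x)⟩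
      exact Module.injective_object_of_injective_module A (E × F)
    · refine ⟨X →ₗ[A] E × F, ModuleCat.ofHom (LinearMap.pi fun φ => φ), ?_⟩
      refine (injective_iff_map_eq_zero' (LinearMap.pi fun φ : X →ₗ[A] E × F => φ)).2 fun x => ?_
      refine ⟨fun hx => ?_, fun hx => by simp [hx]⟩
      by_contra hne
      obtain ⟨φ, hφ⟩ := hcog X x hne
      exact hφ (congrFun hx φ)
    · refine ⟨Unit, ModuleCat.ofHom (LinearMap.pi fun _ => LinearMap.id),
        ModuleCat.ofHom (LinearMap.proj ()), ?_⟩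
      rfl
    · refine ⟨κ ⊕ κ,
        ModuleCat.ofHom (LinearMap.pi (Sum.elim
          (fun k => LinearMap.proj k ∘ₗ s ∘ₗ LinearMap.fst A E E)
          (fun k => LinearMap.proj k ∘ₗ s ∘ₗ LinearMap.snd A E E))),
        ModuleCat.ofHom (LinearMap.prod
          (r ∘ₗ LinearMap.funLeft A C Sum.inl) (r ∘ₗ LinearMap.funLeft A C Sum.inr)), ?_⟩
      ext1
      refine LinearMap.ext fun x => Prod.ext (hsr' x.1) (hsr' x.2)
    · intro x y h
      exact hi (congrArg Prod.snd h)
    · rintro ⟨x, y⟩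
      obtain ⟨z, rfl⟩ := hp y
      exact ⟨(x, z), rfl⟩
    · rintro ⟨x, y⟩
      constructor
      · intro h
        obtain ⟨z, rfl⟩ := (hip y).1 (congrArg Prod.snd h)
        exact ⟨z, Prod.ext (congrArg Prod.fst h).symm rfl⟩
      · rintro ⟨z, hz⟩
        obtain ⟨rfl, rfl⟩ := Prod.ext_iff.1 hz
        exact Prod.ext rfl (hip.apply_apply_eq_zero z)

end CotiltingCriterion

/-! ### Injective modules given by coordinates -/

section Coordinates

variable {K A : Type} [Field K] [Ring A] [Algebra K A] {n : Type} [Module A (n → K)]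

/-- The coordinate functions `x ↦ l (t i) (p i • x)` assembled into an `A`-linear map. -/
def coordHom (t : n → n) (p : n → A)
    (hp : ∀ (l : n → A →ₗ[K] K) (a : A),
      (fun i => l (t i) (p i * a)) = a • fun i => l (t i) (p i))
    {X : Type} [AddCommGroup X] [Module A X] [Module K X] [IsScalarTower K A X]
    (l : n → X →ₗ[K] K) : X →ₗ[A] n → K where
  toFun x i := l (t i) (p i • x)
  map_add' x y := by ext i; simp
  map_smul' a x := by
    simpa [mul_smul] using
      hp (fun j => l j ∘ₗ (LinearMap.toSpanSingleton A X x).restrictScalars K) a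

theorem coordHom_apply {t : n → n} {p : n → A}
    (hp : ∀ (l : n → A →ₗ[K] K) (a : A),
      (fun i => l (t i) (p i * a)) = a • fun i => l (t i) (p i))
    {X : Type} [AddCommGroup X] [Module A X] [Module K X] [IsScalarTower K A X]
    (l : n → X →ₗ[K] K) (x : X) (i : n) : coordHom t p hp l x i = l (t i) (p i • x) := rfl

theorem injective_of_coord [IsScalarTower K A (n → K)] {t : n → n} {p : n → A}
    (hp : ∀ (l : n → A →ₗ[K] K) (a : A),
      (fun i => l (t i) (p i * a)) = a • fun i => l (t i) (p i))
    (ht : ∀ (y : n → K) (i : n), (p i • y) (t i) = y i) :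
    Module.Injective A (n → K) := by
  constructor
  intro X Y _ _ _ _ f hf g
  let : Module K X := Module.compHom X (algebraMap K A)
  let : Module K Y := Module.compHom Y (algebraMap K A)
  have : IsScalarTower K A X := ⟨fun k a x => by
    rw [Algebra.smul_def, mul_smul]; rfl⟩
  have : IsScalarTower K A Y := ⟨fun k a x => by
    rw [Algebra.smul_def, mul_smul]; rfl⟩
  obtain ⟨e, he⟩ := (f.restrictScalars K).exists_leftInverse_of_injective
    (LinearMap.ker_eq_bot.2 hf)
  have he' : ∀ x, e (f x) = x := fun x => LinearMap.congr_fun he x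
  refine ⟨coordHom t p hp fun j => LinearMap.proj j ∘ₗ g.restrictScalars K ∘ₗ e, fun x => ?_⟩
  ext i
  have hK : e (p i • f x) = p i • x := by rw [← map_smul, he']
  simp [coordHom_apply, hK, ht]

theorem exists_coordHom_apply_ne_zero {t : n → n} {p : n → A}
    (hp : ∀ (l : n → A →ₗ[K] K) (a : A),
      (fun i => l (t i) (p i * a)) = a • fun i => l (t i) (p i))
    {X : Type} [AddCommGroup X] [Module A X] (x : X) (i : n) (hx : p i • x ≠ 0) :
    ∃ φ : X →ₗ[A] n → K, φ x ≠ 0 := by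
  let : Module K X := Module.compHom X (algebraMap K A)
  have : IsScalarTower K A X := ⟨fun k a x => by
    rw [Algebra.smul_def, mul_smul]; rfl⟩
  by_contra! hzero
  exact hx ((Module.forall_dual_apply_eq_zero_iff K _).1 fun l =>
    congrFun (hzero (coordHom t p hp fun _ => l)) i)

end Coordinates

/-! ### The two algebras -/

/-- The path algebra of the quiver `4 → 5 → 6`: the coefficients are those of the idempotents
`e₄, e₅, e₆`, of the arrows `4 → 5`, `5 → 6` and of the path `4 → 6`. -/
@[ext]
structure LinearPathAlgebra (K : Type) where
  e₄ : K
  e₅ : K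
  e₆ : K
  p : K
  q : K
  r : K

namespace LinearPathAlgebra

variable {K : Type} [Field K]

instance : Zero (LinearPathAlgebra K) := ⟨⟨0, 0, 0, 0, 0, 0⟩⟩
instance : One (LinearPathAlgebra K) := ⟨⟨1, 1, 1, 0, 0, 0⟩⟩
instance : Add (LinearPathAlgebra K) :=
  ⟨fun x y => ⟨x.e₄ + y.e₄, x.e₅ + y.e₅, x.e₆ + y.e₆, x.p + y.p, x.q + y.q, x.r + y.r⟩⟩
instance : Neg (LinearPathAlgebra K) := ⟨fun x => ⟨-x.e₄, -x.e₅, -x.e₆, -x.p, -x.q, -x.r⟩⟩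
instance : Mul (LinearPathAlgebra K) :=
  ⟨fun x y => ⟨x.e₄ * y.e₄, x.e₅ * y.e₅, x.e₆ * y.e₆, x.p * y.e₄ + x.e₅ * y.p,
    x.q * y.e₅ + x.e₆ * y.q, x.r * y.e₄ + x.q * y.p + x.e₆ * y.r⟩⟩
instance : SMul K (LinearPathAlgebra K) :=
  ⟨fun k x => ⟨k * x.e₄, k * x.e₅, k * x.e₆, k * x.p, k * x.q, k * x.r⟩⟩

theorem zero_def : (0 : LinearPathAlgebra K) = ⟨0, 0, 0, 0, 0, 0⟩ := rfl
theorem one_def : (1 : LinearPathAlgebra K) = ⟨1, 1, 1, 0, 0, 0⟩ := rfl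
theorem add_def (x y : LinearPathAlgebra K) : x + y =
  ⟨x.e₄ + y.e₄, x.e₅ + y.e₅, x.e₆ + y.e₆, x.p + y.p, x.q + y.q, x.r + y.r⟩ := rfl
theorem neg_def (x : LinearPathAlgebra K) :
  -x = ⟨-x.e₄, -x.e₅, -x.e₆, -x.p, -x.q, -x.r⟩ := rfl
theorem mul_def (x y : LinearPathAlgebra K) : x * y =
  ⟨x.e₄ * y.e₄, x.e₅ * y.e₅, x.e₆ * y.e₆, x.p * y.e₄ + x.e₅ * y.p,
    x.q * y.e₅ + x.e₆ * y.q, x.r * y.e₄ + x.q * y.p + x.e₆ * y.r⟩ := rfl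
theorem smul_def (k : K) (x : LinearPathAlgebra K) :
  k • x = ⟨k * x.e₄, k * x.e₅, k * x.e₆, k * x.p, k * x.q, k * x.r⟩ := rfl

instance : AddCommGroup (LinearPathAlgebra K) where
  add_assoc x y z := by ext <;> simp only [add_def] <;> ring
  zero_add x := by ext <;> simp only [add_def, zero_def] <;> ring
  add_zero x := by ext <;> simp only [add_def, zero_def] <;> ring
  neg_add_cancel x := by ext <;> simp only [add_def, zero_def, neg_def] <;> ring
  add_comm x y := by ext <;> simp only [add_def] <;> ring
  nsmul := nsmulRec
  zsmul := zsmulRec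

instance : Ring (LinearPathAlgebra K) where
  __ := (inferInstance : AddCommGroup (LinearPathAlgebra K))
  zero_mul x := by ext <;> simp only [mul_def, zero_def] <;> ring
  mul_zero x := by ext <;> simp only [mul_def, zero_def] <;> ring
  one_mul x := by ext <;> simp only [mul_def, one_def] <;> ring
  mul_one x := by ext <;> simp only [mul_def, one_def] <;> ring
  mul_assoc x y z := by ext <;> simp only [mul_def] <;> ring
  left_distrib x y z := by ext <;> simp only [mul_def, add_def] <;> ring
  right_distrib x y z := by ext <;> simp only [mul_def, add_def] <;> ring

instance : Module K (LinearPathAlgebra K) where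
  one_smul x := by ext <;> simp only [smul_def] <;> ring
  mul_smul x y z := by ext <;> simp only [smul_def] <;> ring
  smul_zero x := by ext <;> simp only [smul_def, zero_def] <;> ring
  zero_smul x := by ext <;> simp only [smul_def, zero_def] <;> ring
  smul_add k x y := by ext <;> simp only [smul_def, add_def] <;> ring
  add_smul k l x := by ext <;> simp only [smul_def, add_def] <;> ring

instance : Algebra K (LinearPathAlgebra K) := Algebra.ofModule
  (fun k x y => by ext <;> simp only [smul_def, mul_def] <;> ring)
  (fun k x y => by ext <;> simp only [smul_def, mul_def] <;> ring)

instance : Module.Finite K (LinearPathAlgebra K) :=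
  Module.Finite.of_surjective
    ({  toFun := fun y => ⟨y 0, y 1, y 2, y 3, y 4, y 5⟩
        map_add' := fun _ _ => rfl
        map_smul' := fun _ _ => rfl } : (Fin 6 → K) →ₗ[K] LinearPathAlgebra K)
    fun x => ⟨![x.e₄, x.e₅, x.e₆, x.p, x.q, x.r], rfl⟩

theorem dual_apply (l : LinearPathAlgebra K →ₗ[K] K) (x : LinearPathAlgebra K) :
    l x = x.e₄ * l ⟨1, 0, 0, 0, 0, 0⟩ + x.e₅ * l ⟨0, 1, 0, 0, 0, 0⟩ +
      x.e₆ * l ⟨0, 0, 1, 0, 0, 0⟩ + x.p * l ⟨0, 0, 0, 1, 0, 0⟩ +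
      x.q * l ⟨0, 0, 0, 0, 1, 0⟩ + x.r * l ⟨0, 0, 0, 0, 0, 1⟩ := by
  simp only [← smul_eq_mul, ← map_smul, ← map_add]
  congr 1
  ext <;> simp [smul_def, add_def]

end LinearPathAlgebra

/-- The algebra of the quiver `1 → 2 → 3` whose two arrows compose to zero: the coefficients
are those of the idempotents `e₁, e₂, e₃` and of the arrows `a : 1 → 2`, `b : 2 → 3`, with
`a = e₁ a e₂` and `b = e₂ b e₃`, so that right modules are representations of the quiver. -/
@[ext]
structure ZeroRelationAlgebra (K : Type) where
  e₁ : K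
  e₂ : K
  e₃ : K
  a : K
  b : K

namespace ZeroRelationAlgebra

variable {K : Type} [Field K]

instance : Zero (ZeroRelationAlgebra K) := ⟨⟨0, 0, 0, 0, 0⟩⟩
instance : One (ZeroRelationAlgebra K) := ⟨⟨1, 1, 1, 0, 0⟩⟩
instance : Add (ZeroRelationAlgebra K) :=
  ⟨fun x y => ⟨x.e₁ + y.e₁, x.e₂ + y.e₂, x.e₃ + y.e₃, x.a + y.a, x.b + y.b⟩⟩
instance : Neg (ZeroRelationAlgebra K) := ⟨fun x => ⟨-x.e₁, -x.e₂, -x.e₃, -x.a, -x.b⟩⟩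
instance : Mul (ZeroRelationAlgebra K) :=
  ⟨fun x y => ⟨x.e₁ * y.e₁, x.e₂ * y.e₂, x.e₃ * y.e₃, x.a * y.e₂ + x.e₁ * y.a,
    x.b * y.e₃ + x.e₂ * y.b⟩⟩
instance : SMul K (ZeroRelationAlgebra K) :=
  ⟨fun k x => ⟨k * x.e₁, k * x.e₂, k * x.e₃, k * x.a, k * x.b⟩⟩

theorem zero_def : (0 : ZeroRelationAlgebra K) = ⟨0, 0, 0, 0, 0⟩ := rfl
theorem one_def : (1 : ZeroRelationAlgebra K) = ⟨1, 1, 1, 0, 0⟩ := rfl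
theorem add_def (x y : ZeroRelationAlgebra K) : x + y =
  ⟨x.e₁ + y.e₁, x.e₂ + y.e₂, x.e₃ + y.e₃, x.a + y.a, x.b + y.b⟩ := rfl
theorem neg_def (x : ZeroRelationAlgebra K) : -x = ⟨-x.e₁, -x.e₂, -x.e₃, -x.a, -x.b⟩ := rfl
theorem mul_def (x y : ZeroRelationAlgebra K) : x * y =
  ⟨x.e₁ * y.e₁, x.e₂ * y.e₂, x.e₃ * y.e₃, x.a * y.e₂ + x.e₁ * y.a,
    x.b * y.e₃ + x.e₂ * y.b⟩ := rfl
theorem smul_def (k : K) (x : ZeroRelationAlgebra K) :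
  k • x = ⟨k * x.e₁, k * x.e₂, k * x.e₃, k * x.a, k * x.b⟩ := rfl

instance : AddCommGroup (ZeroRelationAlgebra K) where
  add_assoc x y z := by ext <;> simp only [add_def] <;> ring
  zero_add x := by ext <;> simp only [add_def, zero_def] <;> ring
  add_zero x := by ext <;> simp only [add_def, zero_def] <;> ring
  neg_add_cancel x := by ext <;> simp only [add_def, zero_def, neg_def] <;> ring
  add_comm x y := by ext <;> simp only [add_def] <;> ring
  nsmul := nsmulRec
  zsmul := zsmulRec

instance : Ring (ZeroRelationAlgebra K) where
  __ := (inferInstance : AddCommGroup (ZeroRelationAlgebra K))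
  zero_mul x := by ext <;> simp only [mul_def, zero_def] <;> ring
  mul_zero x := by ext <;> simp only [mul_def, zero_def] <;> ring
  one_mul x := by ext <;> simp only [mul_def, one_def] <;> ring
  mul_one x := by ext <;> simp only [mul_def, one_def] <;> ring
  mul_assoc x y z := by ext <;> simp only [mul_def] <;> ring
  left_distrib x y z := by ext <;> simp only [mul_def, add_def] <;> ring
  right_distrib x y z := by ext <;> simp only [mul_def, add_def] <;> ring

instance : Module K (ZeroRelationAlgebra K) where
  one_smul x := by ext <;> simp only [smul_def] <;> ring
  mul_smul x y z := by ext <;> simp only [smul_def] <;> ring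
  smul_zero x := by ext <;> simp only [smul_def, zero_def] <;> ring
  zero_smul x := by ext <;> simp only [smul_def, zero_def] <;> ring
  smul_add k x y := by ext <;> simp only [smul_def, add_def] <;> ring
  add_smul k l x := by ext <;> simp only [smul_def, add_def] <;> ring

instance : Algebra K (ZeroRelationAlgebra K) := Algebra.ofModule
  (fun k x y => by ext <;> simp only [smul_def, mul_def] <;> ring)
  (fun k x y => by ext <;> simp only [smul_def, mul_def] <;> ring)

instance : Module.Finite K (ZeroRelationAlgebra K) :=
  Module.Finite.of_surjective
    ({  toFun := fun y => ⟨y 0, y 1, y 2, y 3, y 4⟩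
        map_add' := fun _ _ => rfl
        map_smul' := fun _ _ => rfl } : (Fin 5 → K) →ₗ[K] ZeroRelationAlgebra K)
    fun x => ⟨![x.e₁, x.e₂, x.e₃, x.a, x.b], rfl⟩

theorem dual_op_apply (l : (ZeroRelationAlgebra K)ᵐᵒᵖ →ₗ[K] K) (x : (ZeroRelationAlgebra K)ᵐᵒᵖ) :
    l x = x.unop.e₁ * l (.op ⟨1, 0, 0, 0, 0⟩) + x.unop.e₂ * l (.op ⟨0, 1, 0, 0, 0⟩) +
      x.unop.e₃ * l (.op ⟨0, 0, 1, 0, 0⟩) + x.unop.a * l (.op ⟨0, 0, 0, 1, 0⟩) +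
      x.unop.b * l (.op ⟨0, 0, 0, 0, 1⟩) := by
  simp only [← smul_eq_mul, ← map_smul, ← map_add]
  congr 1
  apply MulOpposite.unop_injective
  ext <;> simp [smul_def, add_def]

end ZeroRelationAlgebra

/-! ### The bimodule and its injective coresolutions -/

section Modules

variable {K : Type} [Field K]

/-- The left module `S₆ ⊕ U ⊕ S₄`, where `U` is uniserial of length `3`. -/
instance : SMul (LinearPathAlgebra K) (Fin 5 → K) where
  smul s w := ![s.e₆ * w 0, s.e₄ * w 1, s.p * w 1 + s.e₅ * w 2,
      s.r * w 1 + s.q * w 2 + s.e₆ * w 3, s.e₄ * w 4]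

theorem left_smul_five (s : (LinearPathAlgebra K)) (w : Fin 5 → K) :
    s • w = ![s.e₆ * w 0, s.e₄ * w 1, s.p * w 1 + s.e₅ * w 2,
      s.r * w 1 + s.q * w 2 + s.e₆ * w 3, s.e₄ * w 4] := rfl

instance : Module (LinearPathAlgebra K) (Fin 5 → K) where
  one_smul w := by
    ext i; fin_cases i <;> simp [left_smul_five, LinearPathAlgebra.one_def]
  mul_smul s t w := by
    ext i; fin_cases i <;> simp [left_smul_five, LinearPathAlgebra.mul_def] <;> ring
  smul_zero s := by
    ext i; fin_cases i <;> simp [left_smul_five]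
  zero_smul w := by
    ext i; fin_cases i <;> simp [left_smul_five, LinearPathAlgebra.zero_def]
  smul_add s v w := by
    ext i; fin_cases i <;> simp [left_smul_five] <;> ring
  add_smul s t w := by
    ext i; fin_cases i <;> simp [left_smul_five, LinearPathAlgebra.add_def] <;> ring

instance : IsScalarTower K (LinearPathAlgebra K) (Fin 5 → K) where
  smul_assoc k s w := by
    ext i; fin_cases i <;> simp [left_smul_five, LinearPathAlgebra.smul_def] <;> ring

/-- The left module `U ⊕ U ⊕ S₄`, where `U` is uniserial of length `3`. -/
instance : SMul (LinearPathAlgebra K) (Fin 7 → K) where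
  smul s w := ![s.e₄ * w 0, s.p * w 0 + s.e₅ * w 1, s.r * w 0 + s.q * w 1 + s.e₆ * w 2,
      s.e₄ * w 3, s.p * w 3 + s.e₅ * w 4, s.r * w 3 + s.q * w 4 + s.e₆ * w 5, s.e₄ * w 6]

theorem left_smul_seven (s : (LinearPathAlgebra K)) (w : Fin 7 → K) :
    s • w = ![s.e₄ * w 0, s.p * w 0 + s.e₅ * w 1, s.r * w 0 + s.q * w 1 + s.e₆ * w 2,
      s.e₄ * w 3, s.p * w 3 + s.e₅ * w 4, s.r * w 3 + s.q * w 4 + s.e₆ * w 5, s.e₄ * w 6] := rfl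

instance : Module (LinearPathAlgebra K) (Fin 7 → K) where
  one_smul w := by
    ext i; fin_cases i <;> simp [left_smul_seven, LinearPathAlgebra.one_def]
  mul_smul s t w := by
    ext i; fin_cases i <;> simp [left_smul_seven, LinearPathAlgebra.mul_def] <;> ring
  smul_zero s := by
    ext i; fin_cases i <;> simp [left_smul_seven]
  zero_smul w := by
    ext i; fin_cases i <;> simp [left_smul_seven, LinearPathAlgebra.zero_def]
  smul_add s v w := by
    ext i; fin_cases i <;> simp [left_smul_seven] <;> ring
  add_smul s t w := by
    ext i; fin_cases i <;> simp [left_smul_seven, LinearPathAlgebra.add_def] <;> ring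

instance : IsScalarTower K (LinearPathAlgebra K) (Fin 7 → K) where
  smul_assoc k s w := by
    ext i; fin_cases i <;> simp [left_smul_seven, LinearPathAlgebra.smul_def] <;> ring

/-- The left module `U / S₆`, where `U` is uniserial of length `3`. -/
instance : SMul (LinearPathAlgebra K) (Fin 2 → K) where
  smul s w := ![s.e₄ * w 0, s.p * w 0 + s.e₅ * w 1]

theorem left_smul_two (s : (LinearPathAlgebra K)) (w : Fin 2 → K) :
    s • w = ![s.e₄ * w 0, s.p * w 0 + s.e₅ * w 1] := rfl

instance : Module (LinearPathAlgebra K) (Fin 2 → K) where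
  one_smul w := by
    ext i; fin_cases i <;> simp [left_smul_two, LinearPathAlgebra.one_def]
  mul_smul s t w := by
    ext i; fin_cases i <;> simp [left_smul_two, LinearPathAlgebra.mul_def] <;> ring
  smul_zero s := by
    ext i; fin_cases i <;> simp [left_smul_two]
  zero_smul w := by
    ext i; fin_cases i <;> simp [left_smul_two, LinearPathAlgebra.zero_def]
  smul_add s v w := by
    ext i; fin_cases i <;> simp [left_smul_two] <;> ring
  add_smul s t w := by
    ext i; fin_cases i <;> simp [left_smul_two, LinearPathAlgebra.add_def] <;> ring

instance : IsScalarTower K (LinearPathAlgebra K) (Fin 2 → K) where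
  smul_assoc k s w := by
    ext i; fin_cases i <;> simp [left_smul_two, LinearPathAlgebra.smul_def] <;> ring

/-- The left module structure on the injective envelope of the right module `C`. -/
instance : SMul (LinearPathAlgebra K) (Fin 6 → K) where
  smul s w := ![s.e₆ * w 0 + s.q * w 2, s.r * w 4 + s.q * w 3 + s.e₆ * w 1,
      s.e₅ * w 2, s.p * w 4 + s.e₅ * w 3, s.e₄ * w 4, s.e₄ * w 5]

theorem left_smul_six (s : (LinearPathAlgebra K)) (w : Fin 6 → K) :
    s • w = ![s.e₆ * w 0 + s.q * w 2, s.r * w 4 + s.q * w 3 + s.e₆ * w 1,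
      s.e₅ * w 2, s.p * w 4 + s.e₅ * w 3, s.e₄ * w 4, s.e₄ * w 5] := rfl

instance : Module (LinearPathAlgebra K) (Fin 6 → K) where
  one_smul w := by
    ext i; fin_cases i <;> simp [left_smul_six, LinearPathAlgebra.one_def]
  mul_smul s t w := by
    ext i; fin_cases i <;> simp [left_smul_six, LinearPathAlgebra.mul_def] <;> ring
  smul_zero s := by
    ext i; fin_cases i <;> simp [left_smul_six]
  zero_smul w := by
    ext i; fin_cases i <;> simp [left_smul_six, LinearPathAlgebra.zero_def]
  smul_add s v w := by
    ext i; fin_cases i <;> simp [left_smul_six] <;> ring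
  add_smul s t w := by
    ext i; fin_cases i <;> simp [left_smul_six, LinearPathAlgebra.add_def] <;> ring

instance : IsScalarTower K (LinearPathAlgebra K) (Fin 6 → K) where
  smul_assoc k s w := by
    ext i; fin_cases i <;> simp [left_smul_six, LinearPathAlgebra.smul_def] <;> ring

/-- The right module `I₂ ⊕ S₂ ⊕ I₃`, where `I₂` and `I₃` are uniserial of length `2`. -/
instance : SMul (ZeroRelationAlgebra K)ᵐᵒᵖ (Fin 5 → K) where
  smul t w := ![t.unop.e₁ * w 0, t.unop.e₂ * w 1, t.unop.e₂ * w 2,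
      t.unop.a * w 0 + t.unop.e₂ * w 3, t.unop.b * w 1 + t.unop.e₃ * w 4]

theorem right_smul_five (t : (ZeroRelationAlgebra K)ᵐᵒᵖ) (w : Fin 5 → K) :
    t • w = ![t.unop.e₁ * w 0, t.unop.e₂ * w 1, t.unop.e₂ * w 2,
      t.unop.a * w 0 + t.unop.e₂ * w 3, t.unop.b * w 1 + t.unop.e₃ * w 4] := rfl

instance : Module (ZeroRelationAlgebra K)ᵐᵒᵖ (Fin 5 → K) where
  one_smul w := by
    ext i; fin_cases i <;> simp [right_smul_five, ZeroRelationAlgebra.one_def]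
  mul_smul s t w := by
    ext i; fin_cases i <;> simp [right_smul_five, ZeroRelationAlgebra.mul_def] <;> ring
  smul_zero s := by
    ext i; fin_cases i <;> simp [right_smul_five]
  zero_smul w := by
    ext i; fin_cases i <;> simp [right_smul_five, ZeroRelationAlgebra.zero_def]
  smul_add s v w := by
    ext i; fin_cases i <;> simp [right_smul_five] <;> ring
  add_smul s t w := by
    ext i; fin_cases i <;> simp [right_smul_five, ZeroRelationAlgebra.add_def] <;> ring

instance : IsScalarTower K (ZeroRelationAlgebra K)ᵐᵒᵖ (Fin 5 → K) where
  smul_assoc k s w := by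
    ext i; fin_cases i <;> simp [right_smul_five, ZeroRelationAlgebra.smul_def] <;> ring

/-- The right module `I₂ ⊕ I₂ ⊕ I₃`, where `I₂` and `I₃` are uniserial of length `2`. -/
instance : SMul (ZeroRelationAlgebra K)ᵐᵒᵖ (Fin 6 → K) where
  smul t w := ![t.unop.e₁ * w 0, t.unop.a * w 0 + t.unop.e₂ * w 1,
      t.unop.e₁ * w 2, t.unop.a * w 2 + t.unop.e₂ * w 3,
      t.unop.e₂ * w 4, t.unop.b * w 4 + t.unop.e₃ * w 5]

theorem right_smul_six (t : (ZeroRelationAlgebra K)ᵐᵒᵖ) (w : Fin 6 → K) :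
    t • w = ![t.unop.e₁ * w 0, t.unop.a * w 0 + t.unop.e₂ * w 1,
      t.unop.e₁ * w 2, t.unop.a * w 2 + t.unop.e₂ * w 3,
      t.unop.e₂ * w 4, t.unop.b * w 4 + t.unop.e₃ * w 5] := rfl

instance : Module (ZeroRelationAlgebra K)ᵐᵒᵖ (Fin 6 → K) where
  one_smul w := by
    ext i; fin_cases i <;> simp [right_smul_six, ZeroRelationAlgebra.one_def]
  mul_smul s t w := by
    ext i; fin_cases i <;> simp [right_smul_six, ZeroRelationAlgebra.mul_def] <;> ring
  smul_zero s := by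
    ext i; fin_cases i <;> simp [right_smul_six]
  zero_smul w := by
    ext i; fin_cases i <;> simp [right_smul_six, ZeroRelationAlgebra.zero_def]
  smul_add s v w := by
    ext i; fin_cases i <;> simp [right_smul_six] <;> ring
  add_smul s t w := by
    ext i; fin_cases i <;> simp [right_smul_six, ZeroRelationAlgebra.add_def] <;> ring

instance : IsScalarTower K (ZeroRelationAlgebra K)ᵐᵒᵖ (Fin 6 → K) where
  smul_assoc k s w := by
    ext i; fin_cases i <;> simp [right_smul_six, ZeroRelationAlgebra.smul_def] <;> ring

/-- The simple right module `S₁`. -/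
instance : SMul (ZeroRelationAlgebra K)ᵐᵒᵖ (Fin 1 → K) where
  smul t w := ![t.unop.e₁ * w 0]

theorem right_smul_one (t : (ZeroRelationAlgebra K)ᵐᵒᵖ) (w : Fin 1 → K) :
    t • w = ![t.unop.e₁ * w 0] := rfl

instance : Module (ZeroRelationAlgebra K)ᵐᵒᵖ (Fin 1 → K) where
  one_smul w := by
    ext i; fin_cases i <;> simp [right_smul_one, ZeroRelationAlgebra.one_def]
  mul_smul s t w := by
    ext i; fin_cases i <;> simp [right_smul_one, ZeroRelationAlgebra.mul_def] <;> ring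
  smul_zero s := by
    ext i; fin_cases i <;> simp [right_smul_one]
  zero_smul w := by
    ext i; fin_cases i <;> simp [right_smul_one, ZeroRelationAlgebra.zero_def]
  smul_add s v w := by
    ext i; fin_cases i <;> simp [right_smul_one] <;> ring
  add_smul s t w := by
    ext i; fin_cases i <;> simp [right_smul_one, ZeroRelationAlgebra.add_def] <;> ring

instance : IsScalarTower K (ZeroRelationAlgebra K)ᵐᵒᵖ (Fin 1 → K) where
  smul_assoc k s w := by
    ext i; fin_cases i <;> simp [right_smul_one, ZeroRelationAlgebra.smul_def] <;> ring

instance : SMulCommClass (LinearPathAlgebra K) (ZeroRelationAlgebra K)ᵐᵒᵖ (Fin 5 → K) where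
  smul_comm s t w := by
    ext i; fin_cases i <;> simp [left_smul_five, right_smul_five] <;> ring

instance : SMulCommClass (LinearPathAlgebra K) (ZeroRelationAlgebra K)ᵐᵒᵖ (Fin 6 → K) where
  smul_comm s t w := by
    ext i; fin_cases i <;> simp [left_smul_six, right_smul_six] <;> ring

/-- The socle coordinate of the summand of `U ⊕ U ⊕ S₄` to which each coordinate belongs. -/
def leftSocle : Fin 7 → Fin 7 := ![2, 2, 2, 5, 5, 5, 6]

/-- The paths to the socle coordinates of `U ⊕ U ⊕ S₄`. -/
def leftPath : Fin 7 → LinearPathAlgebra K :=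
  ![⟨0, 0, 0, 0, 0, 1⟩, ⟨0, 0, 0, 0, 1, 0⟩, ⟨0, 0, 1, 0, 0, 0⟩,
    ⟨0, 0, 0, 0, 0, 1⟩, ⟨0, 0, 0, 0, 1, 0⟩, ⟨0, 0, 1, 0, 0, 0⟩, ⟨1, 0, 0, 0, 0, 0⟩]

theorem leftPath_spec (l : Fin 7 → LinearPathAlgebra K →ₗ[K] K) (s : LinearPathAlgebra K) :
    (fun i => l (leftSocle i) (leftPath i * s)) = s • fun i => l (leftSocle i) (leftPath i) := by
  ext i
  rw [LinearPathAlgebra.dual_apply]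
  fin_cases i <;>
    simp [left_smul_seven, leftSocle, leftPath, LinearPathAlgebra.mul_def] <;> ring

instance : Module.Injective (LinearPathAlgebra K) (Fin 7 → K) :=
  injective_of_coord leftPath_spec fun y i => by
    fin_cases i <;> simp [left_smul_seven, leftSocle, leftPath]

/-- The paths to the socle coordinate of `U / S₆`. -/
def leftQuotPath : Fin 2 → LinearPathAlgebra K := ![⟨0, 0, 0, 1, 0, 0⟩, ⟨0, 1, 0, 0, 0, 0⟩]

theorem leftQuotPath_spec (l : Fin 2 → LinearPathAlgebra K →ₗ[K] K) (s : LinearPathAlgebra K) :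
    (fun i => l ((fun _ => 1) i) (leftQuotPath i * s)) =
      s • fun i => l ((fun _ => 1) i) (leftQuotPath i) := by
  ext i
  rw [LinearPathAlgebra.dual_apply]
  fin_cases i <;>
    simp [left_smul_two, leftQuotPath, LinearPathAlgebra.mul_def] <;> ring

instance : Module.Injective (LinearPathAlgebra K) (Fin 2 → K) :=
  injective_of_coord leftQuotPath_spec fun y i => by
    fin_cases i <;> simp [left_smul_two, leftQuotPath]

/-- The embedding of `C` into its injective envelope. -/
def leftEnvelopeMap : (Fin 5 → K) →ₗ[LinearPathAlgebra K] Fin 7 → K where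
  toFun w := ![0, 0, w 0, w 1, w 2, w 3, w 4]
  map_add' v w := by ext i; fin_cases i <;> simp
  map_smul' s w := by
    ext i; fin_cases i <;> simp [left_smul_five, left_smul_seven]

theorem leftEnvelopeMap_apply (w : Fin 5 → K) :
    leftEnvelopeMap w = ![0, 0, w 0, w 1, w 2, w 3, w 4] := rfl

/-- The cokernel of the embedding of `C` into its injective envelope. -/
def leftCokernelMap : (Fin 7 → K) →ₗ[LinearPathAlgebra K] Fin 2 → K where
  toFun w := ![w 0, w 1]
  map_add' v w := by ext i; fin_cases i <;> simp
  map_smul' s w := by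
    ext i; fin_cases i <;> simp [left_smul_two, left_smul_seven]

theorem leftCokernelMap_apply (w : Fin 7 → K) :
    leftCokernelMap w = ![w 0, w 1] := rfl

/-- The injective envelope of `C` embeds into `C × C` as a direct summand. -/
def leftEnvelopeSection : (Fin 7 → K) →ₗ[LinearPathAlgebra K] Fin 2 → Fin 5 → K where
  toFun w := ![![0, w 0, w 1, w 2, 0], ![0, w 3, w 4, w 5, w 6]]
  map_add' v w := by ext i j; fin_cases i <;> fin_cases j <;> simp
  map_smul' s w := by
    ext i j; fin_cases i <;> fin_cases j <;> simp [left_smul_five, left_smul_seven]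

theorem leftEnvelopeSection_apply (w : Fin 7 → K) :
    leftEnvelopeSection w = ![![0, w 0, w 1, w 2, 0], ![0, w 3, w 4, w 5, w 6]] := rfl

/-- A retraction onto the injective envelope of `C`. -/
def leftEnvelopeRetraction : (Fin 2 → Fin 5 → K) →ₗ[LinearPathAlgebra K] Fin 7 → K where
  toFun w := ![w 0 1, w 0 2, w 0 3, w 1 1, w 1 2, w 1 3, w 1 4]
  map_add' v w := by ext i; fin_cases i <;> simp
  map_smul' s w := by
    ext i; fin_cases i <;> simp [left_smul_five, left_smul_seven]

theorem leftEnvelopeRetraction_apply (w : Fin 2 → Fin 5 → K) :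
    leftEnvelopeRetraction w = ![w 0 1, w 0 2, w 0 3, w 1 1, w 1 2, w 1 3, w 1 4] := rfl

theorem leftEnvelopeMap_injective :
    Function.Injective (leftEnvelopeMap : (Fin 5 → K) → Fin 7 → K) := by
  intro v w h
  ext j
  fin_cases j
  exacts [congrFun h 2, congrFun h 3, congrFun h 4, congrFun h 5, congrFun h 6]

theorem left_exact :
    Function.Exact (leftEnvelopeMap : (Fin 5 → K) → Fin 7 → K) leftCokernelMap := by
  intro w
  constructor
  · intro h
    refine ⟨![w 2, w 3, w 4, w 5, w 6], ?_⟩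
    have h₀ : w 0 = 0 := congrFun h 0
    have h₁ : w 1 = 0 := congrFun h 1
    ext j; fin_cases j <;> simp [leftEnvelopeMap_apply, h₀, h₁]
  · rintro ⟨v, rfl⟩
    ext j; fin_cases j <;> simp [leftEnvelopeMap_apply, leftCokernelMap_apply]

theorem leftCokernelMap_surjective :
    Function.Surjective (leftCokernelMap : (Fin 7 → K) → Fin 2 → K) := by
  intro v
  refine ⟨![v 0, v 1, 0, 0, 0, 0, 0], ?_⟩
  ext j; fin_cases j <;> simp [leftCokernelMap_apply]

theorem left_exists_lift (ι : Type) (φ : (ι → Fin 5 → K) →ₗ[LinearPathAlgebra K] Fin 2 → K) :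
    ∃ ψ : (ι → Fin 5 → K) →ₗ[LinearPathAlgebra K] Fin 7 → K, leftCokernelMap ∘ₗ ψ = φ := by
  let τ : (ι → Fin 5 → K) →ₗ[K] ι → Fin 5 → K :=
    { toFun := fun w k => ![0, 0, w k 3, 0, 0]
      map_add' := fun v w => by ext k j; fin_cases j <;> simp
      map_smul' := fun s w => by ext k j; fin_cases j <;> simp }
  refine ⟨coordHom leftSocle leftPath leftPath_spec fun _ =>
    LinearMap.proj 1 ∘ₗ φ.restrictScalars K ∘ₗ τ, ?_⟩
  ext w j
  have h₀ : φ w 0 = φ (τ ((⟨0, 0, 0, 0, 0, 1⟩ : LinearPathAlgebra K) • w)) 1 := by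
    have : τ ((⟨0, 0, 0, 0, 0, 1⟩ : LinearPathAlgebra K) • w) =
        (⟨0, 0, 0, 1, 0, 0⟩ : LinearPathAlgebra K) • w := by
      ext k j; fin_cases j <;> simp [τ, left_smul_five]
    rw [this, map_smul]
    simp [left_smul_two]
  have h₁ : φ w 1 = φ (τ ((⟨0, 0, 0, 0, 1, 0⟩ : LinearPathAlgebra K) • w)) 1 := by
    have : τ ((⟨0, 0, 0, 0, 1, 0⟩ : LinearPathAlgebra K) • w) =
        (⟨0, 1, 0, 0, 0, 0⟩ : LinearPathAlgebra K) • w := by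
      ext k j; fin_cases j <;> simp [τ, left_smul_five]
    rw [this, map_smul]
    simp [left_smul_two]
  fin_cases j
  exacts [h₀.symm, h₁.symm]

theorem leftEnvelopeRetraction_comp :
    (leftEnvelopeRetraction ∘ₗ leftEnvelopeSection :
      (Fin 7 → K) →ₗ[LinearPathAlgebra K] Fin 7 → K) = LinearMap.id := by
  ext w j
  fin_cases j <;> simp [leftEnvelopeSection_apply, leftEnvelopeRetraction_apply]

theorem left_exists_apply_ne_zero (X : Type) [AddCommGroup X] [Module (LinearPathAlgebra K) X]
    (x : X) (hx : x ≠ 0) :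
    ∃ φ : X →ₗ[LinearPathAlgebra K] (Fin 7 → K) × (Fin 2 → K), φ x ≠ 0 := by
  by_cases h₆ : (⟨0, 0, 1, 0, 0, 0⟩ : LinearPathAlgebra K) • x = 0
  · by_cases h₅ : (⟨0, 1, 0, 0, 0, 0⟩ : LinearPathAlgebra K) • x = 0
    · have h₄ : (⟨1, 0, 0, 0, 0, 0⟩ : LinearPathAlgebra K) • x ≠ 0 := by
        intro h₄
        apply hx
        rw [← one_smul (LinearPathAlgebra K) x,
          show (1 : LinearPathAlgebra K) = ⟨1, 0, 0, 0, 0, 0⟩ + ⟨0, 1, 0, 0, 0, 0⟩ +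
            ⟨0, 0, 1, 0, 0, 0⟩ by
              simp [LinearPathAlgebra.one_def, LinearPathAlgebra.add_def],
          add_smul, add_smul, h₄, h₅, h₆]
        simp
      obtain ⟨φ, hφ⟩ :=
        exists_coordHom_apply_ne_zero (t := leftSocle) (p := leftPath) leftPath_spec x 6 h₄
      exact ⟨φ.prod 0, fun h => hφ (congrArg Prod.fst h)⟩
    · obtain ⟨φ, hφ⟩ :=
        exists_coordHom_apply_ne_zero (t := fun _ => 1) (p := leftQuotPath) leftQuotPath_spec x 1 h₅
      exact ⟨LinearMap.prod 0 φ, fun h => hφ (congrArg Prod.snd h)⟩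
  · obtain ⟨φ, hφ⟩ :=
      exists_coordHom_apply_ne_zero (t := leftSocle) (p := leftPath) leftPath_spec x 2 h₆
    exact ⟨φ.prod 0, fun h => hφ (congrArg Prod.fst h)⟩

theorem left_isClassicalCotilting : IsClassicalCotilting (LinearPathAlgebra K) (Fin 5 → K) :=
  isClassicalCotilting_of_coresolution (Fin 5 → K) (Fin 7 → K) (Fin 2 → K)
    leftEnvelopeMap leftCokernelMap leftEnvelopeMap_injective left_exact leftCokernelMap_surjective
    left_exists_lift (Fin 2) leftEnvelopeSection leftEnvelopeRetraction
    leftEnvelopeRetraction_comp left_exists_apply_ne_zero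

/-- The socle coordinate of the summand of `I₂ ⊕ I₂ ⊕ I₃` to which each coordinate belongs. -/
def rightSocle : Fin 6 → Fin 6 := ![1, 1, 3, 3, 5, 5]

/-- The paths to the socle coordinates of `I₂ ⊕ I₂ ⊕ I₃`. -/
def rightPath : Fin 6 → (ZeroRelationAlgebra K)ᵐᵒᵖ :=
  ![.op ⟨0, 0, 0, 1, 0⟩, .op ⟨0, 1, 0, 0, 0⟩, .op ⟨0, 0, 0, 1, 0⟩, .op ⟨0, 1, 0, 0, 0⟩,
    .op ⟨0, 0, 0, 0, 1⟩, .op ⟨0, 0, 1, 0, 0⟩]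

theorem rightPath_spec (l : Fin 6 → (ZeroRelationAlgebra K)ᵐᵒᵖ →ₗ[K] K)
    (t : (ZeroRelationAlgebra K)ᵐᵒᵖ) :
    (fun i => l (rightSocle i) (rightPath i * t)) =
      t • fun i => l (rightSocle i) (rightPath i) := by
  ext i
  rw [ZeroRelationAlgebra.dual_op_apply]
  fin_cases i <;>
    simp [right_smul_six, rightSocle, rightPath, ZeroRelationAlgebra.mul_def] <;> ring

instance : Module.Injective (ZeroRelationAlgebra K)ᵐᵒᵖ (Fin 6 → K) :=
  injective_of_coord rightPath_spec fun y i => by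
    fin_cases i <;> simp [right_smul_six, rightSocle, rightPath]

theorem rightQuotPath_spec (l : Fin 1 → (ZeroRelationAlgebra K)ᵐᵒᵖ →ₗ[K] K)
    (t : (ZeroRelationAlgebra K)ᵐᵒᵖ) :
    (fun i => l (id i) ((fun _ => .op ⟨1, 0, 0, 0, 0⟩) i * t)) =
      t • fun i => l (id i) ((fun _ => .op ⟨1, 0, 0, 0, 0⟩) i) := by
  ext i
  rw [ZeroRelationAlgebra.dual_op_apply]
  fin_cases i
  simp [right_smul_one, ZeroRelationAlgebra.mul_def]

instance : Module.Injective (ZeroRelationAlgebra K)ᵐᵒᵖ (Fin 1 → K) :=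
  injective_of_coord rightQuotPath_spec fun y i => by
    fin_cases i; simp [right_smul_one]

/-- The embedding of `C` into its right injective envelope. -/
def rightEnvelopeMap : (Fin 5 → K) →ₗ[(ZeroRelationAlgebra K)ᵐᵒᵖ] Fin 6 → K where
  toFun w := ![w 0, w 3, 0, w 2, w 1, w 4]
  map_add' v w := by ext i; fin_cases i <;> simp
  map_smul' s w := by ext i; fin_cases i <;> simp [right_smul_five, right_smul_six]

theorem rightEnvelopeMap_apply (w : Fin 5 → K) :
    rightEnvelopeMap w = ![w 0, w 3, 0, w 2, w 1, w 4] := rfl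

theorem rightEnvelopeMap_injective :
    Function.Injective (rightEnvelopeMap : (Fin 5 → K) → Fin 6 → K) := by
  intro v w h
  ext j
  fin_cases j
  exacts [congrFun h 0, congrFun h 4, congrFun h 3, congrFun h 1, congrFun h 5]

/-- The cokernel of the embedding of `C` into its injective envelope. -/
def rightCokernelMap : (Fin 6 → K) →ₗ[(ZeroRelationAlgebra K)ᵐᵒᵖ] Fin 1 → K where
  toFun w := ![w 2]
  map_add' v w := by ext i; fin_cases i; simp
  map_smul' s w := by
    ext i; fin_cases i; simp [right_smul_one, right_smul_six]

theorem rightCokernelMap_apply (w : Fin 6 → K) :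
    rightCokernelMap w = ![w 2] := rfl

/-- The injective envelope of `C` embeds into `C × C` as a direct summand. -/
def rightEnvelopeSection : (Fin 6 → K) →ₗ[(ZeroRelationAlgebra K)ᵐᵒᵖ] Fin 2 → Fin 5 → K where
  toFun w := ![![w 0, w 4, 0, w 1, w 5], ![w 2, 0, 0, w 3, 0]]
  map_add' v w := by ext i j; fin_cases i <;> fin_cases j <;> simp
  map_smul' s w := by
    ext i j; fin_cases i <;> fin_cases j <;> simp [right_smul_five, right_smul_six]

theorem rightEnvelopeSection_apply (w : Fin 6 → K) :
    rightEnvelopeSection w = ![![w 0, w 4, 0, w 1, w 5], ![w 2, 0, 0, w 3, 0]] := rfl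

/-- A retraction onto the injective envelope of `C`. -/
def rightEnvelopeRetraction : (Fin 2 → Fin 5 → K) →ₗ[(ZeroRelationAlgebra K)ᵐᵒᵖ] Fin 6 → K where
  toFun w := ![w 0 0, w 0 3, w 1 0, w 1 3, w 0 1, w 0 4]
  map_add' v w := by ext i; fin_cases i <;> simp
  map_smul' s w := by
    ext i; fin_cases i <;> simp [right_smul_five, right_smul_six]

theorem rightEnvelopeRetraction_apply (w : Fin 2 → Fin 5 → K) :
    rightEnvelopeRetraction w = ![w 0 0, w 0 3, w 1 0, w 1 3, w 0 1, w 0 4] := rfl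

theorem right_exact :
    Function.Exact (rightEnvelopeMap : (Fin 5 → K) → Fin 6 → K) rightCokernelMap := by
  intro w
  constructor
  · intro h
    refine ⟨![w 0, w 4, w 3, w 1, w 5], ?_⟩
    have h₀ : w 2 = 0 := congrFun h 0
    ext j; fin_cases j <;> simp [rightEnvelopeMap_apply, h₀]
  · rintro ⟨v, rfl⟩
    ext j; fin_cases j; simp [rightEnvelopeMap_apply, rightCokernelMap_apply]

theorem rightCokernelMap_surjective :
    Function.Surjective (rightCokernelMap : (Fin 6 → K) → Fin 1 → K) := by
  intro v
  refine ⟨![0, 0, v 0, 0, 0, 0], ?_⟩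
  ext j; fin_cases j; simp [rightCokernelMap_apply]

theorem right_exists_lift (ι : Type) (φ : (ι → Fin 5 → K) →ₗ[(ZeroRelationAlgebra K)ᵐᵒᵖ] Fin 1 → K) :
    ∃ ψ : (ι → Fin 5 → K) →ₗ[(ZeroRelationAlgebra K)ᵐᵒᵖ] Fin 6 → K, rightCokernelMap ∘ₗ ψ = φ := by
  let τ : (ι → Fin 5 → K) →ₗ[K] ι → Fin 5 → K :=
    { toFun := fun w k => ![w k 3, 0, 0, 0, 0]
      map_add' := fun v w => by ext k j; fin_cases j <;> simp
      map_smul' := fun s w => by ext k j; fin_cases j <;> simp }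
  refine ⟨coordHom rightSocle rightPath rightPath_spec fun _ =>
    LinearMap.proj 0 ∘ₗ φ.restrictScalars K ∘ₗ τ, ?_⟩
  ext w j
  have h₀ : φ w 0 =
      φ (τ ((.op ⟨0, 0, 0, 1, 0⟩ : (ZeroRelationAlgebra K)ᵐᵒᵖ) • w)) 0 := by
    have : τ ((.op ⟨0, 0, 0, 1, 0⟩ : (ZeroRelationAlgebra K)ᵐᵒᵖ) • w) =
        (.op ⟨1, 0, 0, 0, 0⟩ : (ZeroRelationAlgebra K)ᵐᵒᵖ) • w := by
      ext k j; fin_cases j <;> simp [τ, right_smul_five]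
    rw [this, map_smul]
    simp [right_smul_one]
  fin_cases j
  exact h₀.symm

theorem rightEnvelopeRetraction_comp :
    (rightEnvelopeRetraction ∘ₗ rightEnvelopeSection :
      (Fin 6 → K) →ₗ[(ZeroRelationAlgebra K)ᵐᵒᵖ] Fin 6 → K) = LinearMap.id := by
  ext w j
  fin_cases j <;> simp [rightEnvelopeSection_apply, rightEnvelopeRetraction_apply]

theorem right_exists_apply_ne_zero (X : Type) [AddCommGroup X] [Module (ZeroRelationAlgebra K)ᵐᵒᵖ X]
    (x : X) (hx : x ≠ 0) :
    ∃ φ : X →ₗ[(ZeroRelationAlgebra K)ᵐᵒᵖ] (Fin 6 → K) × (Fin 1 → K), φ x ≠ 0 := by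
  by_cases h₁ : (.op ⟨1, 0, 0, 0, 0⟩ : (ZeroRelationAlgebra K)ᵐᵒᵖ) • x = 0
  · by_cases h₂ : (.op ⟨0, 1, 0, 0, 0⟩ : (ZeroRelationAlgebra K)ᵐᵒᵖ) • x = 0
    · have h₃ : (.op ⟨0, 0, 1, 0, 0⟩ : (ZeroRelationAlgebra K)ᵐᵒᵖ) • x ≠ 0 := by
        intro h₃
        apply hx
        rw [← one_smul (ZeroRelationAlgebra K)ᵐᵒᵖ x,
          show (1 : (ZeroRelationAlgebra K)ᵐᵒᵖ) = .op ⟨1, 0, 0, 0, 0⟩ +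
            .op ⟨0, 1, 0, 0, 0⟩ + .op ⟨0, 0, 1, 0, 0⟩ by
              rw [← MulOpposite.op_add, ← MulOpposite.op_add, ← MulOpposite.op_one]
              simp [ZeroRelationAlgebra.one_def, ZeroRelationAlgebra.add_def],
          add_smul, add_smul, h₁, h₂, h₃]
        simp
      obtain ⟨φ, hφ⟩ :=
        exists_coordHom_apply_ne_zero (t := rightSocle) (p := rightPath) rightPath_spec x 5 h₃
      exact ⟨φ.prod 0, fun h => hφ (congrArg Prod.fst h)⟩
    · obtain ⟨φ, hφ⟩ :=
        exists_coordHom_apply_ne_zero (t := rightSocle) (p := rightPath) rightPath_spec x 1 h₂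
      exact ⟨φ.prod 0, fun h => hφ (congrArg Prod.fst h)⟩
  · obtain ⟨φ, hφ⟩ :=
      exists_coordHom_apply_ne_zero (t := id) (p := fun _ => MulOpposite.op (⟨1, 0, 0, 0, 0⟩ : ZeroRelationAlgebra K))
        rightQuotPath_spec x 0 h₁
    exact ⟨LinearMap.prod 0 φ, fun h => hφ (congrArg Prod.snd h)⟩

theorem right_isClassicalCotilting :
    IsClassicalCotilting (ZeroRelationAlgebra K)ᵐᵒᵖ (Fin 5 → K) :=
  isClassicalCotilting_of_coresolution (Fin 5 → K) (Fin 6 → K) (Fin 1 → K)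
    rightEnvelopeMap rightCokernelMap rightEnvelopeMap_injective right_exact
    rightCokernelMap_surjective
    right_exists_lift (Fin 2) rightEnvelopeSection rightEnvelopeRetraction
    rightEnvelopeRetraction_comp right_exists_apply_ne_zero

theorem left_faithfullyBalanced :
    Function.Bijective (Module.toModuleEnd (ZeroRelationAlgebra K)ᵐᵒᵖ (Fin 5 → K) :
      LinearPathAlgebra K →+* Module.End (ZeroRelationAlgebra K)ᵐᵒᵖ (Fin 5 → K)) := by
  refine ⟨fun s t h => ?_, fun φ => ?_⟩
  · have h₀ : s • (![1, 0, 0, 0, 0] : Fin 5 → K) = t • ![1, 0, 0, 0, 0] :=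
      LinearMap.congr_fun h _
    have h₁ : s • (![0, 1, 0, 0, 0] : Fin 5 → K) = t • ![0, 1, 0, 0, 0] :=
      LinearMap.congr_fun h _
    have h₂ : s • (![0, 0, 1, 0, 0] : Fin 5 → K) = t • ![0, 0, 1, 0, 0] :=
      LinearMap.congr_fun h _
    simp [left_smul_five] at h₀ h₁ h₂
    ext <;> simp [*]
  · have hx : φ ![1, 0, 0, 0, 0] = ![φ ![1, 0, 0, 0, 0] 0, 0, 0, 0, 0] := by
      have := φ.map_smul (.op ⟨1, 0, 0, 0, 0⟩) ![1, 0, 0, 0, 0]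
      simpa [right_smul_five] using this
    have h₅ : φ ![0, 0, 1, 0, 0] = ![0, 0, φ ![0, 0, 1, 0, 0] 2, φ ![0, 0, 1, 0, 0] 3, 0] := by
      have h := φ.map_smul (.op ⟨0, 1, 0, 0, 0⟩) ![0, 0, 1, 0, 0]
      have h' := φ.map_smul (.op ⟨0, 0, 0, 0, 1⟩) ![0, 0, 1, 0, 0]
      simp [right_smul_five] at h h'
      have hz : (![0, 0, 0, 0, 0] : Fin 5 → K) = 0 := by
        ext i; fin_cases i <;> rfl
      rw [hz, map_zero] at h'
      have h₀ := congrFun h' 4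
      simp at h₀
      rwa [← h₀] at h
    have h₄ : φ ![0, 1, 0, 0, 0] = ![0, φ ![0, 1, 0, 0, 0] 1, φ ![0, 1, 0, 0, 0] 2,
        φ ![0, 1, 0, 0, 0] 3, 0] := by
      have := φ.map_smul (.op ⟨0, 1, 0, 0, 0⟩) ![0, 1, 0, 0, 0]
      simpa [right_smul_five] using this
    refine ⟨⟨φ ![0, 1, 0, 0, 0] 1, φ ![0, 0, 1, 0, 0] 2, φ ![1, 0, 0, 0, 0] 0,
      φ ![0, 1, 0, 0, 0] 2, φ ![0, 0, 1, 0, 0] 3, φ ![0, 1, 0, 0, 0] 3⟩, ?_⟩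
    refine LinearMap.ext fun w => ?_
    have hw : w = MulOpposite.op (⟨w 0, 0, 0, w 3, 0⟩ : ZeroRelationAlgebra K) •
          (![1, 0, 0, 0, 0] : Fin 5 → K) +
        MulOpposite.op (⟨0, w 2, 0, 0, 0⟩ : ZeroRelationAlgebra K) • ![0, 0, 1, 0, 0] +
        MulOpposite.op (⟨0, w 1, 0, 0, w 4⟩ : ZeroRelationAlgebra K) • ![0, 1, 0, 0, 0] := by
      ext i; fin_cases i <;> simp [right_smul_five]
    conv_rhs => rw [hw]
    rw [map_add, map_add, map_smul, map_smul, map_smul, hx, h₅, h₄]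
    ext i; fin_cases i <;> simp [left_smul_five, right_smul_five] <;> ring

theorem right_faithfullyBalanced :
    haveI : SMulCommClass (ZeroRelationAlgebra K)ᵐᵒᵖ (LinearPathAlgebra K) (Fin 5 → K) :=
      SMulCommClass.symm _ _ _
    Function.Bijective (Module.toModuleEnd (LinearPathAlgebra K) (Fin 5 → K) :
      (ZeroRelationAlgebra K)ᵐᵒᵖ →+* Module.End (LinearPathAlgebra K) (Fin 5 → K)) := by
  refine ⟨fun s t h => ?_, fun φ => ?_⟩
  · have h₀ : s • (![1, 0, 0, 0, 0] : Fin 5 → K) = t • ![1, 0, 0, 0, 0] :=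
      LinearMap.congr_fun h _
    have h₁ : s • (![0, 1, 0, 0, 0] : Fin 5 → K) = t • ![0, 1, 0, 0, 0] :=
      LinearMap.congr_fun h _
    have h₂ : s • (![0, 0, 0, 0, 1] : Fin 5 → K) = t • ![0, 0, 0, 0, 1] :=
      LinearMap.congr_fun h _
    simp [right_smul_five] at h₀ h₁ h₂
    apply MulOpposite.unop_injective
    ext <;> simp [*]
  · have hx : φ ![1, 0, 0, 0, 0] = ![φ ![1, 0, 0, 0, 0] 0, 0, 0, φ ![1, 0, 0, 0, 0] 3, 0] := by
      have := φ.map_smul ⟨0, 0, 1, 0, 0, 0⟩ ![1, 0, 0, 0, 0]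
      simpa [left_smul_five] using this
    have h₄ : φ ![0, 1, 0, 0, 0] = ![0, φ ![0, 1, 0, 0, 0] 1, 0, 0, φ ![0, 1, 0, 0, 0] 4] := by
      have := φ.map_smul ⟨1, 0, 0, 0, 0, 0⟩ ![0, 1, 0, 0, 0]
      simpa [left_smul_five] using this
    have hv : φ ![0, 0, 0, 0, 1] = ![0, 0, 0, 0, φ ![0, 0, 0, 0, 1] 4] := by
      have h := φ.map_smul ⟨1, 0, 0, 0, 0, 0⟩ ![0, 0, 0, 0, 1]
      have h' := φ.map_smul ⟨0, 0, 0, 1, 0, 0⟩ ![0, 0, 0, 0, 1]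
      simp [left_smul_five] at h h'
      have hz : (![0, 0, 0, 0, 0] : Fin 5 → K) = 0 := by
        ext i; fin_cases i <;> rfl
      rw [hz, map_zero] at h'
      have h₀ := congrFun h' 2
      simp at h₀
      rwa [← h₀] at h
    refine ⟨.op ⟨φ ![1, 0, 0, 0, 0] 0, φ ![0, 1, 0, 0, 0] 1, φ ![0, 0, 0, 0, 1] 4,
      φ ![1, 0, 0, 0, 0] 3, φ ![0, 1, 0, 0, 0] 4⟩, ?_⟩
    refine LinearMap.ext fun w => ?_
    have hw : w = (⟨0, 0, w 0, 0, 0, 0⟩ : LinearPathAlgebra K) •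
          (![1, 0, 0, 0, 0] : Fin 5 → K) +
        (⟨w 1, 0, 0, w 2, 0, w 3⟩ : LinearPathAlgebra K) • ![0, 1, 0, 0, 0] +
        (⟨w 4, 0, 0, 0, 0, 0⟩ : LinearPathAlgebra K) • ![0, 0, 0, 0, 1] := by
      ext i; fin_cases i <;> simp [left_smul_five]
    conv_rhs => rw [hw]
    rw [map_add, map_add, map_smul, map_smul, map_smul, hx, h₄, hv]
    ext i; fin_cases i <;> simp [left_smul_five, right_smul_five] <;> ring

theorem not_hasRightExtension (E : Type) [AddCommGroup E] [Module (LinearPathAlgebra K) E]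
    (j : (Fin 5 → K) →ₗ[LinearPathAlgebra K] E)
    (hj : IsInjEnvelope (LinearPathAlgebra K) (Fin 5 → K) E j) :
    ¬ HasRightExtension (LinearPathAlgebra K) (ZeroRelationAlgebra K) (Fin 5 → K) E j := by
  rintro ⟨m, hcomm, hjr⟩
  obtain ⟨hE, hinj, hess⟩ := hj
  obtain ⟨h, hh⟩ := hE.out leftEnvelopeMap leftEnvelopeMap_injective j
  let x : E := h ![1, 0, 0, 0, 0, 0, 0]
  let z : E := MulOpposite.op (⟨0, 0, 0, 1, 0⟩ : ZeroRelationAlgebra K) • x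
  have hz₄ : (⟨1, 0, 0, 0, 0, 0⟩ : LinearPathAlgebra K) • z = z := by
    rw [hcomm, ← map_smul]
    congr 2
    simp [left_smul_seven]
  have hzr : (⟨0, 0, 0, 0, 0, 1⟩ : LinearPathAlgebra K) • z = j ![0, 0, 0, 1, 0] := by
    have hx : (⟨0, 0, 0, 0, 0, 1⟩ : LinearPathAlgebra K) • x = j ![1, 0, 0, 0, 0] := by
      rw [← hh, ← map_smul]
      congr 1
      ext i; fin_cases i <;> simp [left_smul_seven, leftEnvelopeMap_apply]
    rw [hcomm, hx, ← hjr]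
    congr 1
    ext i; fin_cases i <;> simp [right_smul_five]
  have hz₂ : MulOpposite.op (⟨0, 1, 0, 0, 0⟩ : ZeroRelationAlgebra K) • z = z := by
    rw [← mul_smul, ← MulOpposite.op_mul]
    simp [ZeroRelationAlgebra.mul_def, z]
  have hzb : MulOpposite.op (⟨0, 0, 0, 0, 1⟩ : ZeroRelationAlgebra K) • z = 0 := by
    rw [← mul_smul, ← MulOpposite.op_mul]
    simp [ZeroRelationAlgebra.mul_def, ← ZeroRelationAlgebra.zero_def]
  have hz : z - j ![0, 1, 0, 0, 0] = 0 := by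
    set y := z - j ![0, 1, 0, 0, 0] with hy
    have hy₄ : (⟨1, 0, 0, 0, 0, 0⟩ : LinearPathAlgebra K) • y = y := by
      rw [hy, smul_sub, hz₄, ← map_smul]
      simp [left_smul_five]
    have hyr : (⟨0, 0, 0, 0, 0, 1⟩ : LinearPathAlgebra K) • y = 0 := by
      rw [hy, smul_sub, hzr, ← map_smul]
      simp [left_smul_five]
    have hy₂ : MulOpposite.op (⟨0, 1, 0, 0, 0⟩ : ZeroRelationAlgebra K) • y = y := by
      rw [hy, smul_sub, hz₂, ← hjr]
      simp [right_smul_five]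
    by_contra hne
    obtain ⟨n, ⟨hn, c, rfl⟩, hn0⟩ := (Submodule.ne_bot_iff _).1
      (hess (LinearPathAlgebra K ∙ y) (by simpa [Submodule.span_singleton_eq_bot] using hne))
    obtain ⟨s, hs⟩ := Submodule.mem_span_singleton.1 hn
    have hc₂ : MulOpposite.op (⟨0, 1, 0, 0, 0⟩ : ZeroRelationAlgebra K) • c = c :=
      hinj (by rw [hjr, ← hs, ← hcomm, hy₂])
    have hc : ∀ t : LinearPathAlgebra K,
        ((⟨0, 0, 1, 0, 0, 0⟩ : LinearPathAlgebra K) * t) • c = 0 := by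
      intro t
      apply hinj
      have : (⟨0, 0, 1, 0, 0, 0⟩ : LinearPathAlgebra K) * (t * s) * ⟨1, 0, 0, 0, 0, 0⟩ =
          ⟨0, 0, (t * s).r, 0, 0, 0⟩ * ⟨0, 0, 0, 0, 0, 1⟩ := by
        simp [LinearPathAlgebra.mul_def]
      rw [map_smul, ← hs, ← hy₄, ← mul_smul, ← mul_smul, mul_assoc _ t, this, mul_smul, hyr,
        smul_zero, map_zero]
    apply hn0
    have h₁ := congrFun (hc ⟨0, 0, 0, 0, 0, 1⟩) 3
    have h₂ := congrFun (hc ⟨0, 0, 0, 0, 1, 0⟩) 3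
    have h₃ := congrFun (hc ⟨0, 0, 1, 0, 0, 0⟩) 3
    have h₀ := congrFun hc₂ 0
    have h₄ := congrFun hc₂ 4
    simp [LinearPathAlgebra.mul_def, left_smul_five, right_smul_five] at h₀ h₁ h₂ h₃ h₄
    have : c = 0 := by
      ext i; fin_cases i <;> simp [← h₀, h₁, h₂, h₃, ← h₄]
    rw [this, map_zero]
  rw [sub_eq_zero.1 hz, ← hjr] at hzb
  have := congrFun (hinj (hzb.trans j.map_zero.symm)) 4
  simp [right_smul_five] at this

theorem rightEnvelopeMap_isInjEnvelope :
    IsInjEnvelope (ZeroRelationAlgebra K)ᵐᵒᵖ (Fin 5 → K) (Fin 6 → K) rightEnvelopeMap := by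
  refine ⟨inferInstance, rightEnvelopeMap_injective, fun N hN => ?_⟩
  have hrange : ∀ w : Fin 6 → K, w 2 = 0 → w ∈ LinearMap.range rightEnvelopeMap := fun w hw =>
    ⟨![w 0, w 4, w 3, w 1, w 5], by
      ext i; fin_cases i <;> simp [rightEnvelopeMap_apply, hw]⟩
  obtain ⟨y, hy, hy0⟩ := (Submodule.ne_bot_iff _).1 hN
  refine (Submodule.ne_bot_iff _).2 ?_
  by_cases h : y 2 = 0
  · exact ⟨y, ⟨hy, hrange y h⟩, hy0⟩
  · refine ⟨MulOpposite.op (⟨0, 0, 0, 1, 0⟩ : ZeroRelationAlgebra K) • y,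
      ⟨N.smul_mem _ hy, hrange _ (by simp [right_smul_six])⟩, fun h0 => h ?_⟩
    simpa [right_smul_six] using congrFun h0 3

theorem rightEnvelopeMap_left_smul (s : LinearPathAlgebra K) (c : Fin 5 → K) :
    rightEnvelopeMap (s • c) = s • rightEnvelopeMap c := by
  ext i; fin_cases i <;> simp [left_smul_five, left_smul_six, rightEnvelopeMap_apply]

theorem isCotiltingBimodule :
    IsCotiltingBimodule K (LinearPathAlgebra K) (ZeroRelationAlgebra K) (Fin 5 → K) :=
  ⟨left_faithfullyBalanced, right_faithfullyBalanced, left_isClassicalCotilting,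
    right_isClassicalCotilting⟩

end Modules

/-- There exist a field `K`, finite-dimensional `K`-algebras `S`, `R`, and a
finite-dimensional cotilting `S`-`R`-bimodule `C` such that no `S`-`R`-bimodule `D` containing
`C` as a sub-bimodule has underlying left `S`-module an injective envelope of `C`, while some
`S`-`R`-bimodule `D'` containing `C` as a sub-bimodule has underlying right `R`-module an
injective envelope of the right `R`-module `C`.  In particular such embeddings are not always
possible, and no left-right symmetry holds for this embedding problem. -/
theorem bad_case_cotilting_bimodule_exists : Nonempty BadCaseExample := by
  exact ⟨{
    K := ℚ
    S := LinearPathAlgebra ℚ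
    finS := inferInstance
    R := ZeroRelationAlgebra ℚ
    finR := inferInstance
    C := Fin 5 → ℚ
    finC := inferInstance
    cotilting := isCotiltingBimodule
    noLeftExt := fun E _ _ j hj => not_hasRightExtension E j hj
    E' := Fin 6 → ℚ
    j' := rightEnvelopeMap
    envE' := rightEnvelopeMap_isInjEnvelope
    j'_left_linear := rightEnvelopeMap_left_smul }⟩
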